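/- There does not exist a BH(13,10) matrix; that is, there is no 13×13 complex matrix H all of whose entries are 10th roots of unity satisfying H·H* = 13·I_13. -/

import Mathlib

open Matrix

/-- A Butson-type complex Hadamard matrix of complexity `q`: every entry is a complex
`q`-th root of unity and `H * Hᴴ = n • I` where `n` is the size of the matrix. -/
def IsButson {m : Type*} [Fintype m] [DecidableEq m] (q : ℕ) (H : Matrix m m ℂ) : Prop :=
  (∀ i j, H i j ^ q = 1) ∧ H * H.conjTranspose = (Fintype.card m : ℂ) • 1

/-- The ring `ℤ[w]` for a root `w` of the tenth cyclotomic polynomial, described by the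
integral basis `1, w, w ^ 2, w ^ 3`. -/
def tenthCyclotomicRing (w : ℂ) (hw : w ^ 4 - w ^ 3 + w ^ 2 - w + 1 = 0) : Subring ℂ where
  carrier := {x | ∃ a b c e : ℤ, x = a + b * w + c * w ^ 2 + e * w ^ 3}
  zero_mem' := ⟨0, 0, 0, 0, by simp⟩
  one_mem' := ⟨1, 0, 0, 0, by simp⟩
  add_mem' := by
    rintro _ _ ⟨a, b, c, e, rfl⟩ ⟨a', b', c', e', rfl⟩
    exact ⟨a + a', b + b', c + c', e + e', by push_cast; ring⟩
  neg_mem' := by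
    rintro _ ⟨a, b, c, e, rfl⟩
    exact ⟨-a, -b, -c, -e, by push_cast; ring⟩
  mul_mem' := by
    rintro _ _ ⟨a, b, c, e, rfl⟩ ⟨a', b', c', e', rfl⟩
    refine ⟨a * a' - (b * e' + c * c' + e * b') - (c * e' + e * c'),
      a * b' + b * a' + (b * e' + c * c' + e * b') - e * e',
      a * c' + b * b' + c * a' - (b * e' + c * c' + e * b'),
      a * e' + b * c' + c * b' + e * a' + (b * e' + c * c' + e * b'), ?_⟩
    push_cast
    linear_combination ((b * e' + c * c' + e * b' : ℂ) + (c * e' + e * c') * (w + 1)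
      + e * e' * (w ^ 2 + w)) * hw

theorem int_eq_zero_of_add_mul_golden {t : ℂ} (ht : t ^ 2 = t + 1) {p q : ℤ}
    (h : (p : ℂ) + q * t = 0) : p = 0 ∧ q = 0 := by
  have hpq : (2 * p + q) ^ 2 = 5 * q ^ 2 := by
    have : ((2 * p + q : ℂ)) ^ 2 = 5 * q ^ 2 := by
      linear_combination (4 * p + 4 * q - 4 * q * t : ℂ) * h + 4 * (q : ℂ) ^ 2 * ht
    exact_mod_cast this
  have hq : q = 0 := by
    by_contra hq
    have hirr : Irrational (√5 : ℝ) := by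
      simpa using Nat.Prime.irrational_sqrt (p := 5) (by norm_num)
    refine hirr.ne_rational |2 * p + q| |q| ?_
    rw [Real.sqrt_eq_iff_mul_self_eq (by norm_num) (by positivity)]
    have hq' : (q : ℝ) ≠ 0 := by exact_mod_cast hq
    have hR : ((2 * p + q : ℝ)) ^ 2 = 5 * q ^ 2 := by exact_mod_cast hpq
    push_cast
    rw [div_mul_div_comm, abs_mul_abs_self, abs_mul_abs_self]
    field_simp
    linarith
  subst hq
  refine ⟨?_, rfl⟩
  simpa using h

theorem norm_ne_zero_zmod13 : ∀ a b c : ZMod 13,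
    a * b + b * c + c + (a * c + b - a) = 0 →
    a ^ 2 + b ^ 2 + c ^ 2 + 1 - (a * c + b - a) ≠ 0 := by
  decide

theorem eq_zero_of_ternary_norm_eq_zero_zmod13 : ∀ a b c : ZMod 13,
    a * b + b * c + a * c = 0 → a ^ 2 + b ^ 2 + c ^ 2 - a * c = 0 →
    a = 0 ∧ b = 0 ∧ c = 0 := by
  decide

theorem eq_zero_of_norm_eq_zero_zmod13 {a b c e : ZMod 13}
    (h1 : a * b + b * c + c * e + (a * c + b * e - a * e) = 0)
    (h2 : a ^ 2 + b ^ 2 + c ^ 2 + e ^ 2 - (a * c + b * e - a * e) = 0) :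
    a = 0 ∧ b = 0 ∧ c = 0 ∧ e = 0 := by
  have : Fact (Nat.Prime 13) := ⟨by norm_num⟩
  by_cases he : e = 0
  · subst he
    obtain ⟨ha, hb, hc⟩ := eq_zero_of_ternary_norm_eq_zero_zmod13 a b c
      (by linear_combination h1) (by linear_combination h2)
    exact ⟨ha, hb, hc, rfl⟩
  · refine absurd ?_ (norm_ne_zero_zmod13 (a / e) (b / e) (c / e) ?_)
    · field_simp
      linear_combination h2
    · field_simp
      linear_combination h1

theorem thirteen_dvd {a b c e : ℤ} (h1 : a * b + b * c + c * e + (a * c + b * e - a * e) = 0)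
    (h2 : 13 ∣ a ^ 2 + b ^ 2 + c ^ 2 + e ^ 2 - (a * c + b * e - a * e)) :
    13 ∣ a ∧ 13 ∣ b ∧ 13 ∣ c ∧ 13 ∣ e := by
  have h1' := congrArg (Int.cast : ℤ → ZMod 13) h1
  have h2' := (ZMod.intCast_zmod_eq_zero_iff_dvd _ 13).2 h2
  push_cast at h1' h2'
  simpa [ZMod.intCast_zmod_eq_zero_iff_dvd] using eq_zero_of_norm_eq_zero_zmod13 h1' h2'

theorem norm_ne_odd_pow_thirteen (k : ℕ) : ∀ a b c e : ℤ,
    a * b + b * c + c * e + (a * c + b * e - a * e) = 0 →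
    a ^ 2 + b ^ 2 + c ^ 2 + e ^ 2 - (a * c + b * e - a * e) ≠ 13 ^ (2 * k + 1) := by
  induction k with
  | zero =>
    intro a b c e h1 h2
    obtain ⟨⟨a, rfl⟩, ⟨b, rfl⟩, ⟨c, rfl⟩, ⟨e, rfl⟩⟩ := thirteen_dvd h1 ⟨1, by simpa using h2⟩
    ring_nf at h2
    omega
  | succ k ih =>
    intro a b c e h1 h2
    obtain ⟨⟨a, rfl⟩, ⟨b, rfl⟩, ⟨c, rfl⟩, ⟨e, rfl⟩⟩ :=
      thirteen_dvd h1 ⟨13 ^ (2 * k + 2), by rw [h2]; ring⟩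
    refine ih a b c e (by linarith) ?_
    rw [show 2 * (k + 1) + 1 = (2 * k + 1) + 2 by ring, pow_add] at h2
    linarith

theorem mul_star_ne_odd_pow_thirteen {w : ℂ} (hw : w ^ 4 - w ^ 3 + w ^ 2 - w + 1 = 0)
    (hstar : w * star w = 1) {d : ℂ} (hd : d ∈ tenthCyclotomicRing w hw) (k : ℕ) :
    d * star d ≠ 13 ^ (2 * k + 1) := by
  obtain ⟨a, b, c, e, rfl⟩ := hd
  intro h
  simp only [star_add, star_mul', star_pow, star_intCast] at h
  generalize star w = v at *
  have ht : (w + v) ^ 2 = (w + v) + 1 := by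
    linear_combination v ^ 2 * hw - (w ^ 2 * (w * v + 1) - w * (w * v + 1) + w * v - 1 - v) * hstar
  obtain ⟨h1, h2⟩ := int_eq_zero_of_add_mul_golden ht
    (p := a ^ 2 + b ^ 2 + c ^ 2 + e ^ 2 - (a * c + b * e - a * e) - 13 ^ (2 * k + 1))
    (q := a * b + b * c + c * e + (a * c + b * e - a * e)) (by
      push_cast
      rw [← h]
      linear_combination
        -((b : ℂ) ^ 2 + b * c * (w + v) + b * e * (w ^ 2 + v ^ 2) + c ^ 2 * (w * v + 1)
          + c * e * (w * v + 1) * (w + v) + e ^ 2 * (w ^ 2 * v ^ 2 + w * v + 1)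
          + a * c * -2 + b * e * -2 + a * e * -3 * (w + v)) * hstar
        - (a * c + b * e + a * e * (w + v + 1) : ℂ) * ht)
  exact norm_ne_odd_pow_thirteen k a b c e h2 (by linarith)

theorem no_BH_13_10 : ¬ ∃ H : Matrix (Fin 13) (Fin 13) ℂ, IsButson 10 H := by
  rintro ⟨H, hroot, hH⟩
  obtain ⟨w, hprim⟩ : ∃ w : ℂ, IsPrimitiveRoot w 10 :=
    ⟨_, Complex.isPrimitiveRoot_exp 10 (by norm_num)⟩
  have hw : w ^ 4 - w ^ 3 + w ^ 2 - w + 1 = 0 := by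
    have h10 := hprim.pow_eq_one
    have h5 : w ^ 5 - 1 ≠ 0 := sub_ne_zero.2 (hprim.pow_ne_one_of_pos_of_lt (by norm_num) (by norm_num))
    have h2 : w ^ 2 - 1 ≠ 0 := sub_ne_zero.2 (hprim.pow_ne_one_of_pos_of_lt (by norm_num) (by norm_num))
    have h1 : w + 1 ≠ 0 := fun h => h2 (by linear_combination (w - 1) * h)
    refine (mul_eq_zero.1 ((mul_eq_zero.1 (?_ : (w ^ 5 - 1) * ((w + 1) * _) = 0)).resolve_left h5)).resolve_left h1
    linear_combination h10
  have hstar : w * star w = 1 := by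
    have := Complex.mul_conj' w
    rw [hprim.norm'_eq_one (by norm_num)] at this
    simpa using this
  have hmem : ∀ i j, H i j ∈ tenthCyclotomicRing w hw := by
    intro i j
    obtain ⟨k, -, hk⟩ := hprim.eq_pow_of_pow_eq_one (hroot i j)
    rw [← hk]
    exact pow_mem (show w ∈ tenthCyclotomicRing w hw from ⟨0, 1, 0, 0, by simp⟩) k
  have hdet : H.det ∈ tenthCyclotomicRing w hw := by
    rw [det_apply]
    exact sum_mem fun σ _ => by
      rw [Units.smul_def]
      exact zsmul_mem (prod_mem fun i _ => hmem _ _) _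
  refine mul_star_ne_odd_pow_thirteen hw hstar hdet 6 ?_
  rw [← det_conjTranspose, ← det_mul, hH, det_smul]
  simp
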